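/- In the group G = ⟨a, b | a^8 = b^3 = (ab)^2 = (a^2b^2)^3 = (a^4b^2)^3 = 1⟩, the element ab has order exactly 2 (it is nontrivial). -/

import Mathlib

def octaRels : Set (FreeGroup (Fin 2)) :=
  { (FreeGroup.of 0) ^ 8,
    (FreeGroup.of 1) ^ 3,
    (FreeGroup.of 0 * FreeGroup.of 1) ^ 2,
    ((FreeGroup.of 0) ^ 2 * (FreeGroup.of 1) ^ 2) ^ 3,
    ((FreeGroup.of 0) ^ 4 * (FreeGroup.of 1) ^ 2) ^ 3 }

/-- In `G = ⟨a, b | a⁸ = b³ = (ab)² = (a²b²)³ = (a⁴b²)³ = 1⟩`, the element `ab`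
has order exactly 2. -/
theorem octaGroup_orderOf_ab :
    orderOf (PresentedGroup.of (rels := octaRels) 0 *
      PresentedGroup.of (rels := octaRels) 1) = 2 := by
  refine orderOf_eq_prime ?_ ?_
  · have h : PresentedGroup.mk octaRels
        ((FreeGroup.of 0 * FreeGroup.of 1) ^ 2) = 1 :=
      PresentedGroup.one_of_mem (by simp [octaRels])
    simpa [PresentedGroup.of] using h
  · intro h
    have hf : ∀ r ∈ octaRels, FreeGroup.lift (![-1, 1] : Fin 2 → ℤˣ) r = 1 := by
      intro r hr
      simp only [octaRels, Set.mem_insert_iff, Set.mem_singleton_iff] at hr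
      rcases hr with rfl | rfl | rfl | rfl | rfl <;> simp <;> decide
    have h2 := congrArg (PresentedGroup.toGroup hf) h
    simp only [map_mul, map_one, PresentedGroup.toGroup.of] at h2
    revert h2
    decide
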